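/- The Biedenharn–Elliott (pentagon) identity holds for Wigner 6j-symbols: {j₁ j₂ j₃; j₄ j₅ j₆} · {j₇ j₈ j₃; j₄ j₅ j₉} = Σ_J (-1)^{J + j₁+j₂+j₃+j₄+j₅+j₆+j₇+j₈+j₉} (2J+1) {j₁ j₆ j₅; j₉ j₇ J} {j₂ j₆ j₄; j₉ j₈ J} {j₁ j₂ j₃; j₈ j₇ J}, where the sum runs over all admissible half-integers J. -/

import Mathlib

/-! Spins are represented by their doubles: `a = 2j ∈ ℕ`. -/

/-- Triangle conditions (including integrality of the sum) for doubled spins. -/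
def Admissible (a b c : ℕ) : Prop :=
  c ≤ a + b ∧ b ≤ a + c ∧ a ≤ b + c ∧ (a + b + c) % 2 = 0

instance (a b c : ℕ) : Decidable (Admissible a b c) := by
  unfold Admissible; infer_instance

/-- The triangle coefficient `Δ(abc)² = (a+b-c)!(a-b+c)!(-a+b+c)!/(a+b+c+1)!`
in doubled-spin variables. -/
noncomputable def triCoef (a b c : ℕ) : ℝ :=
  ((Nat.factorial ((a + b - c) / 2) * Nat.factorial ((a + c - b) / 2) *
      Nat.factorial ((b + c - a) / 2) : ℕ) : ℝ) /
    (Nat.factorial ((a + b + c) / 2 + 1) : ℝ)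

/-- The Wigner 6j-symbol `{j₁ j₂ j₃; j₄ j₅ j₆}` (Racah's single-sum formula,
equivalent to the standard contraction of four Wigner 3j-symbols), in
doubled-spin variables `a = 2j₁, …, f = 2j₆`.  It vanishes unless each of the
four triads `(j₁j₂j₃), (j₁j₅j₆), (j₄j₂j₆), (j₄j₅j₃)` is admissible. -/
noncomputable def sixJ (a b c d e f : ℕ) : ℝ :=
  if Admissible a b c ∧ Admissible a e f ∧ Admissible d b f ∧ Admissible d e c then
    Real.sqrt (triCoef a b c * triCoef a e f * triCoef d b f * triCoef d e c) *
      ∑ t ∈ Finset.range ((a + b + d + e) / 2 + 1),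
        if (a + b + c) / 2 ≤ t ∧ (a + e + f) / 2 ≤ t ∧ (d + b + f) / 2 ≤ t ∧
            (d + e + c) / 2 ≤ t ∧ t ≤ (a + b + d + e) / 2 ∧
            t ≤ (b + c + e + f) / 2 ∧ t ≤ (c + a + f + d) / 2 then
          (-1 : ℝ) ^ t * (Nat.factorial (t + 1) : ℝ) /
            ((Nat.factorial (t - (a + b + c) / 2) : ℝ) *
             (Nat.factorial (t - (a + e + f) / 2) : ℝ) *
             (Nat.factorial (t - (d + b + f) / 2) : ℝ) *
             (Nat.factorial (t - (d + e + c) / 2) : ℝ) *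
             (Nat.factorial ((a + b + d + e) / 2 - t) : ℝ) *
             (Nat.factorial ((b + c + e + f) / 2 - t) : ℝ) *
             (Nat.factorial ((c + a + f + d) / 2 - t) : ℝ))
        else 0
  else 0

/-- Inverse factorial `1 / (n / 2)!` of a doubled integer, zero if `n` is negative or odd. -/
noncomputable def halfInvFact (n : ℤ) : ℝ :=
  if 0 ≤ n ∧ n % 2 = 0 then ((Nat.factorial (n / 2).toNat : ℕ) : ℝ)⁻¹ else 0

/-- The factorial, extended by zero to negative integers. -/
noncomputable def intFact (n : ℤ) : ℝ :=
  if 0 ≤ n then (Nat.factorial n.toNat : ℝ) else 0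

lemma halfInvFact_two_mul (n : ℕ) : halfInvFact (2 * n) = ((Nat.factorial n : ℕ) : ℝ)⁻¹ := by
  have h : (2 * (n : ℤ) / 2).toNat = n := by omega
  rw [halfInvFact, if_pos (by omega), h]

lemma halfInvFact_eq_zero_of_neg {n : ℤ} (hn : n < 0) : halfInvFact n = 0 :=
  if_neg (by omega)

lemma nonneg_and_even_of_halfInvFact_ne_zero {n : ℤ} (hn : halfInvFact n ≠ 0) :
    0 ≤ n ∧ n % 2 = 0 := by
  by_contra h
  exact hn (if_neg h)

lemma halfInvFact_sub_two (n : ℤ) : halfInvFact (n - 2) = (n / 2 : ℝ) * halfInvFact n := by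
  by_cases h : 0 ≤ n ∧ n % 2 = 0
  · obtain ⟨k, rfl⟩ : ∃ k : ℕ, n = 2 * k := ⟨(n / 2).toNat, by omega⟩
    rw [halfInvFact_two_mul]
    rcases k with _ | k
    · simp [halfInvFact]
    · rw [show (2 * ((k + 1 : ℕ) : ℤ) - 2) = 2 * (k : ℤ) by push_cast; ring, halfInvFact_two_mul,
        Nat.factorial_succ]
      push_cast
      have : (Nat.factorial k : ℝ) ≠ 0 := by positivity
      field_simp
  · rw [halfInvFact, if_neg (by omega), halfInvFact, if_neg h, mul_zero]

lemma intFact_add_one {n : ℤ} (hn : n ≠ -1) : intFact (n + 1) = (n + 1 : ℝ) * intFact n := by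
  by_cases h : 0 ≤ n
  · lift n to ℕ using h
    rw [intFact, if_pos (by omega), intFact, if_pos (by omega),
      show ((n : ℤ) + 1).toNat = n + 1 by omega, Int.toNat_natCast, Nat.factorial_succ]
    push_cast
    ring
  · rw [intFact, if_neg (by omega), intFact, if_neg h, mul_zero]

/-- Summand of Racah's formula, for integral doubled spins. -/
noncomputable def racahTerm (a b c d e f s : ℤ) : ℝ :=
  (-1) ^ s * intFact (s + 1) * halfInvFact (2 * s - (a + b + c)) *
    halfInvFact (2 * s - (a + e + f)) * halfInvFact (2 * s - (d + b + f)) *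
    halfInvFact (2 * s - (d + e + c)) * halfInvFact (a + b + d + e - 2 * s) *
    halfInvFact (b + c + e + f - 2 * s) * halfInvFact (c + a + f + d - 2 * s)

/-- The sum in Racah's formula, for integral doubled spins. -/
noncomputable def racahSum (a b c d e f : ℤ) : ℝ := ∑' s : ℤ, racahTerm a b c d e f s

/-- Triangle and integrality conditions for integral doubled spins. -/
def IntAdmissible (a b c : ℤ) : Prop :=
  c ≤ a + b ∧ b ≤ a + c ∧ a ≤ b + c ∧ (a + b + c) % 2 = 0

lemma racahTerm_ne_zero {a b c d e f s : ℤ} (h : racahTerm a b c d e f s ≠ 0) :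
    (0 ≤ 2 * s - (a + b + c) ∧ 0 ≤ 2 * s - (a + e + f) ∧ 0 ≤ 2 * s - (d + b + f) ∧
      0 ≤ 2 * s - (d + e + c) ∧ 0 ≤ a + b + d + e - 2 * s ∧ 0 ≤ b + c + e + f - 2 * s ∧
      0 ≤ c + a + f + d - 2 * s) ∧
    IntAdmissible a b c ∧ IntAdmissible a e f ∧ IntAdmissible d b f ∧ IntAdmissible d e c := by
  simp only [racahTerm, mul_ne_zero_iff] at h
  obtain ⟨⟨⟨⟨⟨⟨⟨-, h1⟩, h2⟩, h3⟩, h4⟩, h5⟩, h6⟩, h7⟩ := h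
  have h1 := nonneg_and_even_of_halfInvFact_ne_zero h1
  have h2 := nonneg_and_even_of_halfInvFact_ne_zero h2
  have h3 := nonneg_and_even_of_halfInvFact_ne_zero h3
  have h4 := nonneg_and_even_of_halfInvFact_ne_zero h4
  have h5 := nonneg_and_even_of_halfInvFact_ne_zero h5
  have h6 := nonneg_and_even_of_halfInvFact_ne_zero h6
  have h7 := nonneg_and_even_of_halfInvFact_ne_zero h7
  unfold IntAdmissible
  omega

lemma racahSum_ne_zero {a b c d e f : ℤ} (h : racahSum a b c d e f ≠ 0) :
    IntAdmissible a b c ∧ IntAdmissible a e f ∧ IntAdmissible d b f ∧ IntAdmissible d e c := by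
  obtain ⟨s, hs⟩ : ∃ s, racahTerm a b c d e f s ≠ 0 := by
    by_contra! h0
    exact h (by simp [racahSum, h0])
  exact (racahTerm_ne_zero hs).2

lemma summable_of_bounds {g : ℤ → ℝ} (l u : ℤ) (h : ∀ s, g s ≠ 0 → l ≤ s ∧ s ≤ u) :
    Summable g :=
  summable_of_hasFiniteSupport ((Set.finite_Icc l u).subset fun s hs => h s hs)

lemma summable_racahTerm (a b c d e f : ℤ) : Summable (racahTerm a b c d e f) :=
  summable_of_bounds (-(|a + b + c|)) (|a + b + d + e|) fun s hs => by
    have := (racahTerm_ne_zero hs).1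
    have := neg_abs_le (a + b + c)
    have := le_abs_self (a + b + d + e)
    have := abs_nonneg (a + b + d + e)
    have := abs_nonneg (a + b + c)
    omega

lemma tsum_shift (g : ℤ → ℝ) (k : ℤ) : ∑' s, g (s + k) = ∑' s, g s :=
  (Equiv.addRight k).tsum_eq g

lemma summable_shift {g : ℤ → ℝ} (hg : Summable g) (k : ℤ) : Summable fun s => g (s + k) :=
  (Equiv.addRight k).summable_iff.mpr hg

lemma neg_one_zpow_add_one (s : ℤ) : (-1 : ℝ) ^ (s + 1) = -(-1) ^ s := by
  rw [zpow_add_one₀ (by norm_num)]; ring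

lemma tsum_linear_relation {α β γ : ℝ} {f g k h : ℤ → ℝ} (m n : ℤ) (hf : Summable f)
    (hg : Summable g) (hk : Summable k) (hh : Summable h)
    (H : ∀ s, α * f (s + m) = β * g (s + n) + γ * k (s + m) + h (s + 1) - h s) :
    α * ∑' s, f s = β * ∑' s, g s + γ * ∑' s, k s := by
  have h1 := (summable_shift hf m).hasSum.mul_left α
  have h2 := (((summable_shift hg n).hasSum.mul_left β).add
    ((summable_shift hk m).hasSum.mul_left γ)).add
    ((summable_shift hh 1).hasSum.sub hh.hasSum)
  simp only [tsum_shift] at h1 h2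
  have h3 := h1.unique (h2.congr_fun fun s => by rw [H]; ring)
  rw [h3]; ring

/-- Common shape of the terms in the recurrences of the Racah sum. -/
noncomputable def factTerm (s n₀ n₁ n₂ n₃ m₁ m₂ m₃ : ℤ) : ℝ :=
  (-1) ^ s * intFact (s + 1) * halfInvFact n₀ * halfInvFact n₁ * halfInvFact n₂ *
    halfInvFact n₃ * halfInvFact m₁ * halfInvFact m₂ * halfInvFact m₃

lemma summable_factTerm (t₀ t₁ t₂ t₃ q₁ q₂ q₃ : ℤ) :
    Summable fun s => factTerm s (2 * s - t₀) (2 * s - t₁) (2 * s - t₂) (2 * s - t₃)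
      (q₁ - 2 * s) (q₂ - 2 * s) (q₃ - 2 * s) :=
  summable_of_bounds (-|t₀|) |q₁| fun s hs => by
    simp only [factTerm, mul_ne_zero_iff] at hs
    obtain ⟨⟨⟨⟨⟨⟨⟨-, h1⟩, -⟩, -⟩, -⟩, h5⟩, -⟩, -⟩ := hs
    have h1 := nonneg_and_even_of_halfInvFact_ne_zero h1
    have h5 := nonneg_and_even_of_halfInvFact_ne_zero h5
    have := neg_abs_le t₀
    have := le_abs_self q₁
    have := abs_nonneg q₁
    have := abs_nonneg t₀
    omega

lemma racahTerm_eq_factTerm {A B C x y z s n₀ n₁ n₂ n₃ m₁ m₂ m₃ : ℤ}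
    (h₀ : n₀ = 2 * s - (A + B + C)) (h₁ : n₁ = 2 * s - (A + y + z))
    (h₂ : n₂ = 2 * s - (x + B + z)) (h₃ : n₃ = 2 * s - (x + y + C))
    (k₁ : m₁ = A + B + x + y - 2 * s) (k₂ : m₂ = B + C + y + z - 2 * s)
    (k₃ : m₃ = C + A + z + x - 2 * s) :
    racahTerm A B C x y z s = factTerm s n₀ n₁ n₂ n₃ m₁ m₂ m₃ := by
  subst h₀ h₁ h₂ h₃ k₁ k₂ k₃
  rfl

lemma factTerm_congr {s n₀ n₁ n₂ n₃ m₁ m₂ m₃ n₀' n₁' n₂' n₃' m₁' m₂' m₃' : ℤ}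
    (h₀ : n₀ = n₀') (h₁ : n₁ = n₁') (h₂ : n₂ = n₂') (h₃ : n₃ = n₃')
    (k₁ : m₁ = m₁') (k₂ : m₂ = m₂') (k₃ : m₃ = m₃') :
    factTerm s n₀ n₁ n₂ n₃ m₁ m₂ m₃ = factTerm s n₀' n₁' n₂' n₃' m₁' m₂' m₃' := by
  subst h₀ h₁ h₂ h₃ k₁ k₂ k₃
  rfl

lemma intFact_succ_mul_halfInvFact {s n : ℤ} (h : s = -2 → n < 0) :
    intFact (s + 1 + 1) * halfInvFact n = (s + 2) * intFact (s + 1) * halfInvFact n := by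
  by_cases hs : s = -2
  · rw [halfInvFact_eq_zero_of_neg (h hs)]; ring
  · rw [intFact_add_one (by omega)]; push_cast; ring

lemma racahSum_recurrence_up_up {A B C : ℤ} (hABC : 0 ≤ A + B + C) (x y z : ℤ) :
    ((z : ℝ) + 1) * ((x + y + C) / 2 + 2) * racahSum A B C x y z =
      -(((y + z - A) / 2 + 1) * ((x + z - B) / 2 + 1)) *
          racahSum A B C (x + 1) (y + 1) (z + 1) +
        ((A + y - z) / 2 + 1) * ((B + x - z) / 2 + 1) *
          racahSum A B C (x + 1) (y + 1) (z - 1) := by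
  refine tsum_linear_relation (h := fun s => factTerm s (2 * s - (A + B + C))
    (2 * s - (A + y + z + 2)) (2 * s - (x + B + z + 2)) (2 * s - (x + y + C + 2))
    (A + B + x + y + 2 - 2 * s) (B + C + y + z - 2 * s) (C + A + z + x - 2 * s)) 0 1
    (summable_racahTerm ..) (summable_racahTerm ..) (summable_racahTerm ..)
    (summable_factTerm ..) fun s => ?_
  obtain ⟨p₀, hp₀⟩ : ∃ n, n = 2 * s + 2 - (A + B + C) := ⟨_, rfl⟩
  obtain ⟨p₁, hp₁⟩ : ∃ n, n = 2 * s - (A + y + z) := ⟨_, rfl⟩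
  obtain ⟨p₂, hp₂⟩ : ∃ n, n = 2 * s - (x + B + z) := ⟨_, rfl⟩
  obtain ⟨p₃, hp₃⟩ : ∃ n, n = 2 * s - (x + y + C) := ⟨_, rfl⟩
  obtain ⟨r₁, hr₁⟩ : ∃ n, n = A + B + x + y + 2 - 2 * s := ⟨_, rfl⟩
  obtain ⟨r₂, hr₂⟩ : ∃ n, n = B + C + y + z - 2 * s := ⟨_, rfl⟩
  obtain ⟨r₃, hr₃⟩ : ∃ n, n = C + A + z + x - 2 * s := ⟨_, rfl⟩
  have hF : intFact (s + 1 + 1) * halfInvFact p₀ = (s + 2) * intFact (s + 1) * halfInvFact p₀ :=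
    intFact_succ_mul_halfInvFact (by omega)
  have e1 : racahTerm A B C x y z s = factTerm s (p₀ - 2) p₁ p₂ p₃ (r₁ - 2) r₂ r₃ := by
    apply racahTerm_eq_factTerm <;> omega
  have e2 : racahTerm A B C (x + 1) (y + 1) (z + 1) (s + 1) =
      factTerm (s + 1) p₀ p₁ p₂ p₃ (r₁ - 2) r₂ r₃ := by
    apply racahTerm_eq_factTerm <;> omega
  have e3 : racahTerm A B C (x + 1) (y + 1) (z - 1) s =
      factTerm s (p₀ - 2) p₁ p₂ (p₃ - 2) r₁ r₂ r₃ := by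
    apply racahTerm_eq_factTerm <;> omega
  have e4 : factTerm s (2 * s - (A + B + C))
      (2 * s - (A + y + z + 2)) (2 * s - (x + B + z + 2)) (2 * s - (x + y + C + 2))
      (A + B + x + y + 2 - 2 * s) (B + C + y + z - 2 * s) (C + A + z + x - 2 * s) =
      factTerm s (p₀ - 2) (p₁ - 2) (p₂ - 2) (p₃ - 2) r₁ r₂ r₃ := by
    apply factTerm_congr <;> omega
  have e5 : factTerm (s + 1) (2 * (s + 1) - (A + B + C))
      (2 * (s + 1) - (A + y + z + 2)) (2 * (s + 1) - (x + B + z + 2))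
      (2 * (s + 1) - (x + y + C + 2)) (A + B + x + y + 2 - 2 * (s + 1))
      (B + C + y + z - 2 * (s + 1)) (C + A + z + x - 2 * (s + 1)) =
      factTerm (s + 1) p₀ p₁ p₂ p₃ (r₁ - 2) (r₂ - 2) (r₃ - 2) := by
    apply factTerm_congr <;> omega
  rw [add_zero, e1, e2, e3, e4, e5]
  simp only [factTerm, neg_one_zpow_add_one, halfInvFact_sub_two]
  have key : ((z : ℝ) + 1) * ((x + y + C) / 2 + 2) * (p₀ / 2) * (r₁ / 2) =
      ((y + z - A) / 2 + 1) * ((x + z - B) / 2 + 1) * (s + 2) * (r₁ / 2) +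
        ((A + y - z) / 2 + 1) * ((B + x - z) / 2 + 1) * (p₀ / 2) * (p₃ / 2) -
        (p₀ / 2) * (p₁ / 2) * (p₂ / 2) * (p₃ / 2) -
        (s + 2) * (r₁ / 2) * (r₂ / 2) * (r₃ / 2) := by
    have hp₀ := congrArg (Int.cast (R := ℝ)) hp₀
    have hp₁ := congrArg (Int.cast (R := ℝ)) hp₁
    have hp₂ := congrArg (Int.cast (R := ℝ)) hp₂
    have hp₃ := congrArg (Int.cast (R := ℝ)) hp₃
    have hr₁ := congrArg (Int.cast (R := ℝ)) hr₁
    have hr₂ := congrArg (Int.cast (R := ℝ)) hr₂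
    have hr₃ := congrArg (Int.cast (R := ℝ)) hr₃
    push_cast at hp₀ hp₁ hp₂ hp₃ hr₁ hr₂ hr₃
    rw [hp₀, hp₁, hp₂, hp₃, hr₁, hr₂, hr₃]; ring
  linear_combination (-1 : ℝ) ^ s * halfInvFact p₁ *
    halfInvFact p₂ * halfInvFact p₃ * halfInvFact r₁ * halfInvFact r₂ * halfInvFact r₃ *
    (intFact (s + 1) * halfInvFact p₀ * key -
      (r₁ / 2) * (((y + z - A) / 2 + 1) * ((x + z - B) / 2 + 1) - (r₂ / 2) * (r₃ / 2)) * hF)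

lemma racahSum_recurrence_up_down {A B C : ℤ} (hABC : 0 ≤ A + B + C) (x y z : ℤ) :
    ((z : ℝ) + 1) * ((C + y - x) / 2) * racahSum A B C x y z =
      ((x + z - B) / 2 + 1) * ((A + z - y) / 2 + 1) *
          racahSum A B C (x + 1) (y - 1) (z + 1) +
        ((B + x - z) / 2 + 1) * ((A + y + z) / 2 + 1) *
          racahSum A B C (x + 1) (y - 1) (z - 1) := by
  refine tsum_linear_relation (h := fun s => factTerm s (2 * s - (A + B + C + 2))
    (2 * s - (A + y + z)) (2 * s - (x + B + z + 2)) (2 * s - (x + y + C + 2))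
    (A + B + x + y - 2 * s) (B + C + y + z - 2 * s) (C + A + z + x + 2 - 2 * s)) 0 0
    (summable_racahTerm ..) (summable_racahTerm ..) (summable_racahTerm ..)
    (summable_factTerm ..) fun s => ?_
  obtain ⟨p₀, hp₀⟩ : ∃ n, n = 2 * s - (A + B + C) := ⟨_, rfl⟩
  obtain ⟨p₁, hp₁⟩ : ∃ n, n = 2 * s + 2 - (A + y + z) := ⟨_, rfl⟩
  obtain ⟨p₂, hp₂⟩ : ∃ n, n = 2 * s - (x + B + z) := ⟨_, rfl⟩
  obtain ⟨p₃, hp₃⟩ : ∃ n, n = 2 * s - (x + y + C) := ⟨_, rfl⟩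
  obtain ⟨r₁, hr₁⟩ : ∃ n, n = A + B + x + y - 2 * s := ⟨_, rfl⟩
  obtain ⟨r₂, hr₂⟩ : ∃ n, n = B + C + y + z - 2 * s := ⟨_, rfl⟩
  obtain ⟨r₃, hr₃⟩ : ∃ n, n = C + A + z + x + 2 - 2 * s := ⟨_, rfl⟩
  have hF : intFact (s + 1 + 1) * halfInvFact p₀ = (s + 2) * intFact (s + 1) * halfInvFact p₀ :=
    intFact_succ_mul_halfInvFact (by omega)
  have e1 : racahTerm A B C x y z s =
      factTerm s p₀ (p₁ - 2) p₂ p₃ r₁ r₂ (r₃ - 2) := by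
    apply racahTerm_eq_factTerm <;> omega
  have e2 : racahTerm A B C (x + 1) (y - 1) (z + 1) s =
      factTerm s p₀ (p₁ - 2) (p₂ - 2) p₃ r₁ r₂ r₃ := by
    apply racahTerm_eq_factTerm <;> omega
  have e3 : racahTerm A B C (x + 1) (y - 1) (z - 1) s =
      factTerm s p₀ p₁ p₂ p₃ r₁ (r₂ - 2) (r₃ - 2) := by
    apply racahTerm_eq_factTerm <;> omega
  have e4 : factTerm s (2 * s - (A + B + C + 2)) (2 * s - (A + y + z)) (2 * s - (x + B + z + 2))
      (2 * s - (x + y + C + 2)) (A + B + x + y - 2 * s) (B + C + y + z - 2 * s)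
      (C + A + z + x + 2 - 2 * s) =
      factTerm s (p₀ - 2) (p₁ - 2) (p₂ - 2) (p₃ - 2) r₁ r₂ r₃ := by
    apply factTerm_congr <;> omega
  have e5 : factTerm (s + 1) (2 * (s + 1) - (A + B + C + 2)) (2 * (s + 1) - (A + y + z))
      (2 * (s + 1) - (x + B + z + 2)) (2 * (s + 1) - (x + y + C + 2)) (A + B + x + y - 2 * (s + 1))
      (B + C + y + z - 2 * (s + 1)) (C + A + z + x + 2 - 2 * (s + 1)) =
      factTerm (s + 1) p₀ p₁ p₂ p₃ (r₁ - 2) (r₂ - 2) (r₃ - 2) := by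
    apply factTerm_congr <;> omega
  rw [add_zero, e1, e2, e3, e4, e5]
  simp only [factTerm, neg_one_zpow_add_one, halfInvFact_sub_two]
  have key : ((z : ℝ) + 1) * ((C + y - x) / 2) * (p₁ / 2) * (r₃ / 2) =
      ((x + z - B) / 2 + 1) * ((A + z - y) / 2 + 1) * (p₁ / 2) * (p₂ / 2) +
        ((B + x - z) / 2 + 1) * ((A + y + z) / 2 + 1) * (r₂ / 2) * (r₃ / 2) -
        (p₀ / 2) * (p₁ / 2) * (p₂ / 2) * (p₃ / 2) -
        (s + 2) * (r₁ / 2) * (r₂ / 2) * (r₃ / 2) := by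
    have hp₀ := congrArg (Int.cast (R := ℝ)) hp₀
    have hp₁ := congrArg (Int.cast (R := ℝ)) hp₁
    have hp₂ := congrArg (Int.cast (R := ℝ)) hp₂
    have hp₃ := congrArg (Int.cast (R := ℝ)) hp₃
    have hr₁ := congrArg (Int.cast (R := ℝ)) hr₁
    have hr₂ := congrArg (Int.cast (R := ℝ)) hr₂
    have hr₃ := congrArg (Int.cast (R := ℝ)) hr₃
    push_cast at hp₀ hp₁ hp₂ hp₃ hr₁ hr₂ hr₃
    rw [hp₀, hp₁, hp₂, hp₃, hr₁, hr₂, hr₃]; ring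
  linear_combination (-1 : ℝ) ^ s * halfInvFact p₁ *
    halfInvFact p₂ * halfInvFact p₃ * halfInvFact r₁ * halfInvFact r₂ * halfInvFact r₃ *
    (intFact (s + 1) * halfInvFact p₀ * key +
      (r₁ / 2) * (r₂ / 2) * (r₃ / 2) * hF)

lemma racahSum_recurrence_down_down {A B C : ℤ} (hABC : 0 ≤ A + B + C) (x y z : ℤ) :
    ((z : ℝ) + 1) * ((x + y - C) / 2) * racahSum A B C x y z =
      -(((A + y + z) / 2 + 1) * ((B + x + z) / 2 + 1)) *
          racahSum A B C (x - 1) (y - 1) (z - 1) +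
        ((A + z - y) / 2 + 1) * ((B + z - x) / 2 + 1) *
          racahSum A B C (x - 1) (y - 1) (z + 1) := by
  refine tsum_linear_relation (h := fun s => -factTerm s (2 * s - (A + B + C)) (2 * s - (A + y + z))
    (2 * s - (x + B + z)) (2 * s - (x + y + C - 2)) (A + B + x + y - 2 - 2 * s)
    (B + C + y + z - 2 - 2 * s) (C + A + z + x - 2 - 2 * s)) 1 0
    (summable_racahTerm ..) (summable_racahTerm ..) (summable_racahTerm ..)
    (summable_factTerm ..).neg fun s => ?_
  obtain ⟨p₀, hp₀⟩ : ∃ n, n = 2 * s + 2 - (A + B + C) := ⟨_, rfl⟩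
  obtain ⟨p₁, hp₁⟩ : ∃ n, n = 2 * s + 2 - (A + y + z) := ⟨_, rfl⟩
  obtain ⟨p₂, hp₂⟩ : ∃ n, n = 2 * s + 2 - (x + B + z) := ⟨_, rfl⟩
  obtain ⟨p₃, hp₃⟩ : ∃ n, n = 2 * s + 4 - (x + y + C) := ⟨_, rfl⟩
  obtain ⟨r₁, hr₁⟩ : ∃ n, n = A + B + x + y - 2 - 2 * s := ⟨_, rfl⟩
  obtain ⟨r₂, hr₂⟩ : ∃ n, n = B + C + y + z - 2 - 2 * s := ⟨_, rfl⟩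
  obtain ⟨r₃, hr₃⟩ : ∃ n, n = C + A + z + x - 2 - 2 * s := ⟨_, rfl⟩
  have hF : intFact (s + 1 + 1) * halfInvFact p₀ = (s + 2) * intFact (s + 1) * halfInvFact p₀ :=
    intFact_succ_mul_halfInvFact (by omega)
  have e1 : racahTerm A B C x y z (s + 1) =
      factTerm (s + 1) p₀ p₁ p₂ (p₃ - 2) r₁ r₂ r₃ := by
    apply racahTerm_eq_factTerm <;> omega
  have e2 : racahTerm A B C (x - 1) (y - 1) (z - 1) s =
      factTerm s (p₀ - 2) p₁ p₂ (p₃ - 2) r₁ r₂ r₃ := by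
    apply racahTerm_eq_factTerm <;> omega
  have e3 : racahTerm A B C (x - 1) (y - 1) (z + 1) (s + 1) =
      factTerm (s + 1) p₀ p₁ p₂ p₃ (r₁ - 2) r₂ r₃ := by
    apply racahTerm_eq_factTerm <;> omega
  have e4 : factTerm s (2 * s - (A + B + C)) (2 * s - (A + y + z)) (2 * s - (x + B + z))
      (2 * s - (x + y + C - 2)) (A + B + x + y - 2 - 2 * s) (B + C + y + z - 2 - 2 * s)
      (C + A + z + x - 2 - 2 * s) =
      factTerm s (p₀ - 2) (p₁ - 2) (p₂ - 2) (p₃ - 2) r₁ r₂ r₃ := by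
    apply factTerm_congr <;> omega
  have e5 : factTerm (s + 1) (2 * (s + 1) - (A + B + C)) (2 * (s + 1) - (A + y + z))
      (2 * (s + 1) - (x + B + z)) (2 * (s + 1) - (x + y + C - 2)) (A + B + x + y - 2 - 2 * (s + 1))
      (B + C + y + z - 2 - 2 * (s + 1)) (C + A + z + x - 2 - 2 * (s + 1)) =
      factTerm (s + 1) p₀ p₁ p₂ p₃ (r₁ - 2) (r₂ - 2) (r₃ - 2) := by
    apply factTerm_congr <;> omega
  rw [add_zero, e1, e2, e3, e4, e5]
  simp only [factTerm, neg_one_zpow_add_one, halfInvFact_sub_two]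
  have key : -(s + 2) * (((z : ℝ) + 1) * ((x + y - C) / 2)) * (p₃ / 2) =
      -(((A + y + z) / 2 + 1) * ((B + x + z) / 2 + 1)) * (p₀ / 2) * (p₃ / 2) -
        (s + 2) * (((A + z - y) / 2 + 1) * ((B + z - x) / 2 + 1)) * (r₁ / 2) +
        (p₀ / 2) * (p₁ / 2) * (p₂ / 2) * (p₃ / 2) +
        (s + 2) * (r₁ / 2) * (r₂ / 2) * (r₃ / 2) := by
    have hp₀ := congrArg (Int.cast (R := ℝ)) hp₀
    have hp₁ := congrArg (Int.cast (R := ℝ)) hp₁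
    have hp₂ := congrArg (Int.cast (R := ℝ)) hp₂
    have hp₃ := congrArg (Int.cast (R := ℝ)) hp₃
    have hr₁ := congrArg (Int.cast (R := ℝ)) hr₁
    have hr₂ := congrArg (Int.cast (R := ℝ)) hr₂
    have hr₃ := congrArg (Int.cast (R := ℝ)) hr₃
    push_cast at hp₀ hp₁ hp₂ hp₃ hr₁ hr₂ hr₃
    rw [hp₀, hp₁, hp₂, hp₃, hr₁, hr₂, hr₃]; ring
  linear_combination (-1 : ℝ) ^ s * halfInvFact p₁ *
    halfInvFact p₂ * halfInvFact p₃ * halfInvFact r₁ * halfInvFact r₂ * halfInvFact r₃ *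
    (intFact (s + 1) * halfInvFact p₀ * key +
      (-(((z : ℝ) + 1) * ((x + y - C) / 2)) * (p₃ / 2) +
        ((A + z - y) / 2 + 1) * ((B + z - x) / 2 + 1) * (r₁ / 2) -
        (r₁ / 2) * (r₂ / 2) * (r₃ / 2)) * hF)

lemma racahSum_swap (A B C x y z : ℤ) : racahSum A B C x y z = racahSum B A C y x z := by
  refine tsum_congr fun s => ?_
  simp only [racahTerm]
  rw [show 2 * s - (B + A + C) = 2 * s - (A + B + C) by ring,
    show 2 * s - (B + x + z) = 2 * s - (x + B + z) by ring,
    show 2 * s - (y + A + z) = 2 * s - (A + y + z) by ring,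
    show 2 * s - (y + x + C) = 2 * s - (x + y + C) by ring,
    show B + A + y + x - 2 * s = A + B + x + y - 2 * s by ring,
    show A + C + x + z - 2 * s = C + A + z + x - 2 * s by ring,
    show C + B + z + y - 2 * s = B + C + y + z - 2 * s by ring]
  ring

lemma racahSum_flip (A B C x y z : ℤ) : racahSum A B C x y z = racahSum x y C A B z := by
  refine tsum_congr fun s => ?_
  simp only [racahTerm]
  rw [show x + y + A + B - 2 * s = A + B + x + y - 2 * s by ring,
    show y + C + B + z - 2 * s = B + C + y + z - 2 * s by ring,
    show C + x + z + A - 2 * s = C + A + z + x - 2 * s by ring]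
  ring

lemma racahSum_rotate (A B C x y z : ℤ) : racahSum A B C x y z = racahSum B C A y z x := by
  refine tsum_congr fun s => ?_
  simp only [racahTerm]
  rw [show 2 * s - (B + C + A) = 2 * s - (A + B + C) by ring,
    show 2 * s - (B + z + x) = 2 * s - (x + B + z) by ring,
    show 2 * s - (y + C + x) = 2 * s - (x + y + C) by ring,
    show 2 * s - (y + z + A) = 2 * s - (A + y + z) by ring]
  ring

/-- Square of the normalized 6j-symbol with a spin one-half, up to triangle coefficients: the
weight of moving the spins `x, y` adjacent to `C` by `ε, δ ∈ {1, -1}`. -/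
noncomputable def halfWeight (ε δ x y C : ℤ) : ℝ :=
  if ε = δ then ((x : ℝ) + y - ε * C) / 2 + 1 else ((C : ℝ) + ε * (x - y)) / 2 + 1

/-- Sign in the spin one-half recurrence. -/
def halfSign (ε δ ζ : ℤ) : ℝ := if ε = δ ∧ δ = ζ then -1 else 1

lemma racahSum_recurrence {A B C : ℤ} (hABC : 0 ≤ A + B + C) {ε δ : ℤ}
    (hε : ε = 1 ∨ ε = -1) (hδ : δ = 1 ∨ δ = -1) (x y z : ℤ) :
    ((z : ℝ) + 1) * (halfWeight (-ε) (-δ) (x + ε) (y + δ) C * racahSum A B C x y z) =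
      halfSign ε δ 1 * (halfWeight δ 1 y z A * halfWeight ε 1 x z B) *
          racahSum A B C (x + ε) (y + δ) (z + 1) +
        halfSign ε δ (-1) * (halfWeight δ (-1) y z A * halfWeight ε (-1) x z B) *
          racahSum A B C (x + ε) (y + δ) (z - 1) := by
  rcases hε with rfl | rfl <;> rcases hδ with rfl | rfl
  · have h := racahSum_recurrence_up_up hABC x y z
    norm_num [halfWeight, halfSign]
    linear_combination h
  · have h := racahSum_recurrence_up_down hABC x y z
    norm_num [halfWeight, halfSign, ← sub_eq_add_neg]
    linear_combination h
  · have h := racahSum_recurrence_up_down (A := B) (B := A) (C := C) (by omega) y x z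
    rw [racahSum_swap B A C y x z, racahSum_swap B A C (y + 1) (x - 1) (z + 1),
      racahSum_swap B A C (y + 1) (x - 1) (z - 1)] at h
    norm_num [halfWeight, halfSign, ← sub_eq_add_neg]
    linear_combination h
  · have h := racahSum_recurrence_down_down hABC x y z
    norm_num [halfWeight, halfSign, ← sub_eq_add_neg]
    linear_combination h

open Classical in
/-- The triangle coefficient of integral doubled spins, zero if they are not admissible. -/
noncomputable def intTri (a b c : ℤ) : ℝ :=
  if IntAdmissible a b c then
    (Nat.factorial ((a + b - c) / 2).toNat * Nat.factorial ((a + c - b) / 2).toNat *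
      Nat.factorial ((b + c - a) / 2).toNat : ℝ) / Nat.factorial ((a + b + c) / 2 + 1).toNat
  else 0

lemma intTri_eq (p q r : ℕ) : intTri (p + q) (p + r) (q + r) =
    (Nat.factorial p * Nat.factorial q * Nat.factorial r : ℝ) / Nat.factorial (p + q + r + 1) := by
  rw [intTri, if_pos (by unfold IntAdmissible; omega)]
  congr 5 <;> omega

lemma IntAdmissible.exists_nat {a b c : ℤ} (h : IntAdmissible a b c) :
    ∃ p q r : ℕ, a = p + q ∧ b = p + r ∧ c = q + r := by
  unfold IntAdmissible at h
  exact ⟨((a + b - c) / 2).toNat, ((a + c - b) / 2).toNat, ((b + c - a) / 2).toNat, by omega⟩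

lemma IntAdmissible.comm {a b c : ℤ} (h : IntAdmissible a b c) : IntAdmissible b a c := by
  unfold IntAdmissible at *; omega

lemma intTri_up_up {x y C : ℤ} (h : IntAdmissible x y C) :
    (((x : ℝ) + y + C) / 2 + 2) * intTri (x + 1) (y + 1) C =
      (((x : ℝ) + y - C) / 2 + 1) * intTri x y C := by
  obtain ⟨p, q, r, rfl, rfl, rfl⟩ := h.exists_nat
  have h := intTri_eq (p + 1) q r
  rw [show (((p + 1 : ℕ) : ℤ) + q) = p + q + 1 by push_cast; ring,
    show (((p + 1 : ℕ) : ℤ) + r) = p + r + 1 by push_cast; ring] at h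
  rw [h, intTri_eq, show p + 1 + q + r + 1 = (p + q + r + 1) + 1 by ring, Nat.factorial_succ p,
    Nat.factorial_succ (p + q + r + 1)]
  have : (Nat.factorial (p + q + r + 1) : ℝ) ≠ 0 := by positivity
  have : (p : ℝ) + q + r + 1 + 1 ≠ 0 := by positivity
  push_cast
  field_simp
  ring

lemma intTri_up_down {x y C : ℤ} (h : IntAdmissible x y C) (h' : IntAdmissible (x + 1) (y - 1) C) :
    (((C : ℝ) + y - x) / 2) * intTri (x + 1) (y - 1) C =
      (((C : ℝ) + x - y) / 2 + 1) * intTri x y C := by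
  obtain ⟨p, q, r, rfl, rfl, rfl⟩ := h.exists_nat
  unfold IntAdmissible at h'
  obtain ⟨k, rfl⟩ : ∃ k, r = k + 1 := ⟨r - 1, by omega⟩
  have h := intTri_eq p (q + 1) k
  rw [show ((p : ℤ) + (q + 1 : ℕ)) = p + q + 1 by push_cast; ring,
    show ((p : ℤ) + k) = p + (k + 1 : ℕ) - 1 by push_cast; ring,
    show (((q + 1 : ℕ) : ℤ) + k) = q + (k + 1 : ℕ) by push_cast; ring] at h
  rw [h, intTri_eq, show p + (q + 1) + k + 1 = p + q + (k + 1) + 1 by ring, Nat.factorial_succ q,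
    Nat.factorial_succ k]
  have : (Nat.factorial (p + q + (k + 1) + 1) : ℝ) ≠ 0 := by positivity
  push_cast
  field_simp
  ring

lemma intTri_comm (a b c : ℤ) : intTri a b c = intTri b a c := by
  by_cases h : IntAdmissible a b c
  · obtain ⟨p, q, r, rfl, rfl, rfl⟩ := h.exists_nat
    rw [intTri_eq, add_comm (q : ℤ) r, intTri_eq, show p + r + q + 1 = p + q + r + 1 by ring]
    ring
  · rw [intTri, if_neg h, intTri, if_neg fun h' => h h'.comm]

lemma intTri_step {ε δ : ℤ} (hε : ε = 1 ∨ ε = -1) (hδ : δ = 1 ∨ δ = -1) {x y C : ℤ}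
    (h : IntAdmissible x y C) (h' : IntAdmissible (x + ε) (y + δ) C) :
    halfWeight (-ε) (-δ) (x + ε) (y + δ) C * intTri (x + ε) (y + δ) C =
      halfWeight ε δ x y C * intTri x y C := by
  rcases hε with rfl | rfl <;> rcases hδ with rfl | rfl
  · have := intTri_up_up h
    norm_num [halfWeight]
    linear_combination this
  · have := intTri_up_down h h'
    norm_num [halfWeight, ← sub_eq_add_neg]
    linear_combination this
  · have := intTri_up_down h.comm h'.comm
    rw [intTri_comm y, intTri_comm (y + 1)] at this
    norm_num [halfWeight, ← sub_eq_add_neg]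
    linear_combination this
  · have := intTri_up_up h'
    rw [← sub_eq_add_neg, ← sub_eq_add_neg, sub_add_cancel, sub_add_cancel] at this
    norm_num [halfWeight, ← sub_eq_add_neg]
    push_cast at this
    linear_combination -this

lemma halfWeight_eq_zero {ε δ : ℤ} (hε : ε = 1 ∨ ε = -1) (hδ : δ = 1 ∨ δ = -1) {x y C : ℤ}
    (h : IntAdmissible x y C) (h' : ¬ IntAdmissible (x + ε) (y + δ) C) :
    halfWeight (-ε) (-δ) (x + ε) (y + δ) C = 0 := by
  unfold IntAdmissible at h h'
  rcases hε with rfl | rfl <;> rcases hδ with rfl | rfl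
  · omega
  · have : (C : ℝ) + y = x := by exact_mod_cast (by omega : C + y = x)
    norm_num [halfWeight]
    linear_combination this / 2
  · have : (C : ℝ) + x = y := by exact_mod_cast (by omega : C + x = y)
    norm_num [halfWeight]
    linear_combination this / 2
  · have : (x : ℝ) + y = C := by exact_mod_cast (by omega : x + y = C)
    norm_num [halfWeight]
    linear_combination this / 2

lemma intTri_step_mul {ε δ : ℤ} (hε : ε = 1 ∨ ε = -1) (hδ : δ = 1 ∨ δ = -1) {x y C : ℤ} {u : ℝ}
    (hu : u ≠ 0 → IntAdmissible x y C) (h' : IntAdmissible (x + ε) (y + δ) C) :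
    intTri (x + ε) (y + δ) C * (halfWeight (-ε) (-δ) (x + ε) (y + δ) C * u) =
      halfWeight ε δ x y C * intTri x y C * u := by
  by_cases h0 : u = 0
  · simp [h0]
  · linear_combination u * intTri_step hε hδ (hu h0) h'

lemma intTri_step_mul_sq {ε δ : ℤ} (hε : ε = 1 ∨ ε = -1) (hδ : δ = 1 ∨ δ = -1) {x y C : ℤ}
    {u : ℝ} (hu : u ≠ 0 → IntAdmissible x y C) :
    intTri (x + ε) (y + δ) C * halfWeight (-ε) (-δ) (x + ε) (y + δ) C ^ 2 * u =
      halfWeight ε δ x y C * halfWeight (-ε) (-δ) (x + ε) (y + δ) C * intTri x y C * u := by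
  by_cases h0 : u = 0
  · simp [h0]
  by_cases h' : IntAdmissible (x + ε) (y + δ) C
  · linear_combination u * halfWeight (-ε) (-δ) (x + ε) (y + δ) C * intTri_step hε hδ (hu h0) h'
  · rw [halfWeight_eq_zero hε hδ (hu h0) h']; ring

lemma intTri_mul_halfWeight_cross {z j c : ℤ} {u : ℝ}
    (hu : u ≠ 0 → IntAdmissible z (j + 1) c ∧ IntAdmissible z (j - 1) c) :
    intTri (z + 1) j c * (halfWeight (-1) 1 (z + 1) j c * halfWeight (-1) (-1) (z + 1) j c) * u =
      intTri (z - 1) j c * (halfWeight 1 1 (z - 1) j c * halfWeight 1 (-1) (z - 1) j c) * u := by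
  by_cases h0 : u = 0
  · simp [h0]
  obtain ⟨h1, h2⟩ := hu h0
  have h3 : IntAdmissible (z + 1) j c := by unfold IntAdmissible at *; omega
  have h4 : IntAdmissible (z - 1) j c := by unfold IntAdmissible at *; omega
  have e1 := intTri_step (ε := 1) (δ := 1) (by simp) (by simp) h2 (by simpa using h3)
  have e2 := intTri_step (ε := -1) (δ := 1) (by simp) (by simp) h2
    (by simpa [← sub_eq_add_neg] using h4)
  rw [← sub_eq_add_neg, neg_neg] at e2
  rw [sub_add_cancel] at e1 e2
  have e3 : halfWeight 1 1 z (j - 1) c * halfWeight (-1) 1 (z + 1) j c =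
      halfWeight (-1) 1 z (j - 1) c * halfWeight 1 1 (z - 1) j c := by
    norm_num [halfWeight]; ring
  linear_combination u * halfWeight (-1) 1 (z + 1) j c * e1 -
    u * halfWeight 1 1 (z - 1) j c * e2 + u * intTri z (j - 1) c * e3

lemma halfWeight_sum_up (z j c : ℤ) :
    halfWeight 1 (-1) z (j + 1) c * halfWeight (-1) 1 (z + 1) j c +
      halfWeight (-1) (-1) z (j + 1) c * halfWeight 1 1 (z - 1) j c =
      ((z : ℝ) + 1) * (j + 1) := by
  norm_num [halfWeight]; ring

lemma halfWeight_sum_down (z j c : ℤ) :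
    halfWeight 1 1 z (j - 1) c * halfWeight (-1) (-1) (z + 1) j c +
      halfWeight (-1) 1 z (j - 1) c * halfWeight 1 (-1) (z - 1) j c =
      ((z : ℝ) + 1) * (j + 1) := by
  norm_num [halfWeight]; ring

/-- Fusion of two spin one-half recurrences by the orthogonality of the spin one-half weights.
The indices `p` and `m` stand for steps up and down. -/
lemma halfSign_fusion {ε δ : ℤ} (hε : ε = 1 ∨ ε = -1) (hδ : δ = 1 ∨ δ = -1)
    {j z s dp dm ep em wpp wpm wmp wmm vpp vpm vmp vmm Pp Pm Qp Qm Xp Xm Yp Ym : ℝ}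
    (hj : j ≠ 0)
    (hPp : j * Pp = halfSign (-ε) (-1) 1 * wpp * Xp + halfSign (-ε) (-1) (-1) * wpm * Xm)
    (hPm : j * Pm = halfSign (-ε) 1 1 * wmp * Xp + halfSign (-ε) 1 (-1) * wmm * Xm)
    (hQp : j * Qp = halfSign (-δ) (-1) 1 * wpp * Yp + halfSign (-δ) (-1) (-1) * wpm * Ym)
    (hQm : j * Qm = halfSign (-δ) 1 1 * wmp * Yp + halfSign (-δ) 1 (-1) * wmm * Ym)
    (hpp : dp * wpp ^ 2 * Xp = vpp * wpp * ep * Xp)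
    (hmp : dm * wmp ^ 2 * Xp = vmp * wmp * ep * Xp)
    (hpm : dp * wpm ^ 2 * Xm = vpm * wpm * em * Xm)
    (hmm : dm * wmm ^ 2 * Xm = vmm * wmm * em * Xm)
    (hc : dp * (wpp * wpm) * (Xp * Ym) = dm * (wmp * wmm) * (Xp * Ym))
    (hc' : dp * (wpp * wpm) * (Xm * Yp) = dm * (wmp * wmm) * (Xm * Yp))
    (hp : vpp * wpp + vmp * wmp = z * j) (hm : vpm * wpm + vmm * wmm = z * j) :
    (if ε = δ then 1 else -1) * s * j *
        (halfSign ε δ 1 * dp * Pp * Qp - halfSign ε δ (-1) * dm * Pm * Qm) =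
      z * s * (halfSign ε δ 1 * em * Xm * Ym - halfSign ε δ (-1) * ep * Xp * Yp) := by
  apply mul_left_cancel₀ hj
  have h1 : j * ((if ε = δ then 1 else -1) * s * j *
      (halfSign ε δ 1 * dp * Pp * Qp - halfSign ε δ (-1) * dm * Pm * Qm)) =
      (if ε = δ then 1 else -1) * s *
        (halfSign ε δ 1 * dp * (j * Pp) * (j * Qp) -
          halfSign ε δ (-1) * dm * (j * Pm) * (j * Qm)) := by ring
  rw [h1, hPp, hPm, hQp, hQm]
  rcases hε with rfl | rfl <;> rcases hδ with rfl | rfl <;> norm_num [halfSign]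
  · linear_combination s * hc + s * hc' - s * Yp * (hpp + hmp) - s * Ym * (hpm + hmm)
      - s * Xp * Yp * ep * hp - s * Xm * Ym * em * hm
  · linear_combination -s * hc + s * hc' - s * Yp * (hpp + hmp) + s * Ym * (hpm + hmm)
      - s * Xp * Yp * ep * hp + s * Xm * Ym * em * hm
  · linear_combination s * hc - s * hc' - s * Yp * (hpp + hmp) + s * Ym * (hpm + hmm)
      - s * Xp * Yp * ep * hp + s * Xm * Ym * em * hm
  · linear_combination s * hc + s * hc' + s * Yp * (hpp + hmp) + s * Ym * (hpm + hmm)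
      + s * Xp * Yp * ep * hp + s * Xm * Ym * em * hm

/-- The sign `(-1) ^ ⌊n / 2⌋`. -/
noncomputable def halfPow (n : ℤ) : ℝ := (-1) ^ (n / 2)

lemma halfPow_add_two (n : ℤ) : halfPow (n + 2) = -halfPow n := by
  rw [halfPow, show (n + 2) / 2 = n / 2 + 1 by omega, neg_one_zpow_add_one, halfPow]

lemma halfPow_sub_two (n : ℤ) : halfPow (n - 2) = -halfPow n := by
  have := halfPow_add_two (n - 2)
  rw [sub_add_cancel] at this
  linarith

lemma halfPow_add {ε δ : ℤ} (hε : ε = 1 ∨ ε = -1) (hδ : δ = 1 ∨ δ = -1) (n : ℤ) :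
    halfPow (n + ε + δ + 2) = (if ε = δ then 1 else -1) * halfPow n ∧
      halfPow (n + ε + δ) = -((if ε = δ then 1 else -1) * halfPow n) := by
  have h1 := halfPow_add_two n
  have h2 := halfPow_add_two (n + 2)
  have h3 := halfPow_sub_two n
  rcases hε with rfl | rfl <;> rcases hδ with rfl | rfl
  · rw [show n + 1 + 1 + 2 = n + 2 + 2 by ring, show n + 1 + 1 = n + 2 by ring, h2, h1]
    simp
  · rw [show n + 1 + -1 = n by ring, h1]
    norm_num
  · rw [show n + -1 + 1 = n by ring, h1]
    norm_num
  · rw [show n + -1 + -1 + 2 = n by ring, show n + -1 + -1 = n - 2 by ring, h3]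
    simp

/-- The summand of the pentagon sum without square roots, with legs `p, q, r, a, b, c` and loop
variables `x, y, z`. -/
noncomputable def pentagonTerm (p q r a b c x y z J : ℤ) : ℝ :=
  halfPow (J + x + y + z + (p + q + r + a + b + c)) * ((J : ℝ) + 1) *
    (intTri x J a * intTri y J b * intTri z J c) *
    (racahSum c a r x z J * racahSum c b q y z J * racahSum b a p x y J)

/-- The pentagon sum without square roots. -/
noncomputable def pentagonSum (p q r a b c x y z : ℤ) : ℝ :=
  ∑' J : ℤ, pentagonTerm p q r a b c x y z J

/-- The expansion of the spin one-half step of `pentagonTerm` in the recurrence for its last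
6j-symbol. -/
noncomputable def pentagonStep (p q r a b c x y z ε δ η J : ℤ) : ℝ :=
  halfPow (J + x + y + z + (p + q + r + a + b + c)) * ((z : ℝ) + 1) *
    (intTri x J a * intTri y J b * intTri z J c) *
    (racahSum c a r x z J * racahSum c b q y z J) *
    (halfSign ε δ η * (halfWeight ε η x J a * halfWeight δ η y J b) *
      racahSum b a p (x + ε) (y + δ) (J + η))

lemma pentagonTerm_recurrence (p q r a b c : ℤ) (hr : 0 ≤ c + a + r) (hq : 0 ≤ c + b + q) {ε δ : ℤ}
    (hε : ε = 1 ∨ ε = -1) (hδ : δ = 1 ∨ δ = -1) (x y z j : ℤ) :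
    halfSign ε δ 1 * (halfWeight δ 1 y z q * halfWeight ε 1 x z r) *
          pentagonTerm p q r a b c (x + ε) (y + δ) (z + 1) j +
        halfSign ε δ (-1) * (halfWeight δ (-1) y z q * halfWeight ε (-1) x z r) *
          pentagonTerm p q r a b c (x + ε) (y + δ) (z - 1) j =
      pentagonStep p q r a b c x y z ε δ 1 (j - 1) +
        pentagonStep p q r a b c x y z ε δ (-1) (j + 1) := by
  simp only [pentagonTerm, pentagonStep, sub_add_cancel, add_neg_cancel_right]
  by_cases h0 : racahSum b a p (x + ε) (y + δ) j = 0
  · simp [h0]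
  obtain ⟨-, hy, hx, -⟩ := racahSum_ne_zero h0
  have hx : IntAdmissible (x + ε) j a := by unfold IntAdmissible at *; omega
  have hy : IntAdmissible (y + δ) j b := by unfold IntAdmissible at *; omega
  have hj : (j : ℝ) + 1 ≠ 0 := by
    have : 0 ≤ j := by unfold IntAdmissible at hx; omega
    positivity
  have hε' : -ε = 1 ∨ -ε = -1 := by omega
  have hδ' : -δ = 1 ∨ -δ = -1 := by omega
  have hPp := racahSum_recurrence (A := c) (B := a) (C := r) hr hε' (δ := -1) (by simp)
    (x + ε) (z + 1) j
  have hPm := racahSum_recurrence (A := c) (B := a) (C := r) hr hε' (δ := 1) (by simp)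
    (x + ε) (z - 1) j
  have hQp := racahSum_recurrence (A := c) (B := b) (C := q) hq hδ' (δ := -1) (by simp)
    (y + δ) (z + 1) j
  have hQm := racahSum_recurrence (A := c) (B := b) (C := q) hq hδ' (δ := 1) (by simp)
    (y + δ) (z - 1) j
  simp only [neg_neg, add_neg_cancel_right, sub_add_cancel] at hPp hPm hQp hQm
  have hUp : racahSum c a r x z (j + 1) ≠ 0 →
      IntAdmissible z (j + 1) c ∧ IntAdmissible x (j + 1) a := fun h => by
    obtain ⟨-, h1, h2, -⟩ := racahSum_ne_zero h
    unfold IntAdmissible at *; omega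
  have hUm : racahSum c a r x z (j - 1) ≠ 0 →
      IntAdmissible z (j - 1) c ∧ IntAdmissible x (j - 1) a := fun h => by
    obtain ⟨-, h1, h2, -⟩ := racahSum_ne_zero h
    unfold IntAdmissible at *; omega
  have hVp : racahSum c b q y z (j + 1) ≠ 0 →
      IntAdmissible z (j + 1) c ∧ IntAdmissible y (j + 1) b := fun h => by
    obtain ⟨-, h1, h2, -⟩ := racahSum_ne_zero h
    unfold IntAdmissible at *; omega
  have hVm : racahSum c b q y z (j - 1) ≠ 0 →
      IntAdmissible z (j - 1) c ∧ IntAdmissible y (j - 1) b := fun h => by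
    obtain ⟨-, h1, h2, -⟩ := racahSum_ne_zero h
    unfold IntAdmissible at *; omega
  set Up := racahSum c a r x z (j + 1)
  set Um := racahSum c a r x z (j - 1)
  set Vp := racahSum c b q y z (j + 1)
  set Vm := racahSum c b q y z (j - 1)
  have up {α : ℤ} (hα : α = 1 ∨ α = -1) {w : ℤ} {C : ℤ} {u : ℝ}
      (hu : u ≠ 0 → IntAdmissible w (j + 1) C) (h' : IntAdmissible (w + α) j C) :
      intTri (w + α) j C * (halfWeight (-α) 1 (w + α) j C * u) =
        halfWeight α (-1) w (j + 1) C * intTri w (j + 1) C * u := by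
    have := intTri_step_mul hα (δ := -1) (by simp) hu (by simpa using h')
    simpa using this
  have down {α : ℤ} (hα : α = 1 ∨ α = -1) {w : ℤ} {C : ℤ} {u : ℝ}
      (hu : u ≠ 0 → IntAdmissible w (j - 1) C) (h' : IntAdmissible (w + α) j C) :
      intTri (w + α) j C * (halfWeight (-α) (-1) (w + α) j C * u) =
        halfWeight α 1 w (j - 1) C * intTri w (j - 1) C * u := by
    have := intTri_step_mul hα (δ := 1) (by simp) hu (by simpa using h')
    simpa using this
  have hXp := up hε (fun h => (hUp h).2) hx
  have hXm := down hε (fun h => (hUm h).2) hx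
  have hYp := up hδ (fun h => (hVp h).2) hy
  have hYm := down hδ (fun h => (hVm h).2) hy
  set Xp := halfWeight (-ε) 1 (x + ε) j a * Up with hXp_def
  set Xm := halfWeight (-ε) (-1) (x + ε) j a * Um with hXm_def
  set Yp := halfWeight (-δ) 1 (y + δ) j b * Vp with hYp_def
  set Ym := halfWeight (-δ) (-1) (y + δ) j b * Vm with hYm_def
  have hXp' : Xp ≠ 0 → IntAdmissible z (j + 1) c := fun h => (hUp (right_ne_zero_of_mul h)).1
  have hXm' : Xm ≠ 0 → IntAdmissible z (j - 1) c := fun h => (hUm (right_ne_zero_of_mul h)).1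
  have hYp' : Yp ≠ 0 → IntAdmissible z (j + 1) c := fun h => (hVp (right_ne_zero_of_mul h)).1
  have hYm' : Ym ≠ 0 → IntAdmissible z (j - 1) c := fun h => (hVm (right_ne_zero_of_mul h)).1
  have hpp := intTri_step_mul_sq (ε := 1) (δ := -1) (by simp) (by simp) hXp'
  have hmp := intTri_step_mul_sq (ε := -1) (δ := -1) (by simp) (by simp) hXp'
  have hpm := intTri_step_mul_sq (ε := 1) (δ := 1) (by simp) (by simp) hXm'
  have hmm := intTri_step_mul_sq (ε := -1) (δ := 1) (by simp) (by simp) hXm'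
  simp only [neg_neg, sub_add_cancel, add_sub_cancel_right, ← sub_eq_add_neg] at hpp hmp hpm hmm
  have hc := intTri_mul_halfWeight_cross (z := z) (j := j) (c := c) (u := Xp * Ym)
    fun h => ⟨hXp' (left_ne_zero_of_mul h), hYm' (right_ne_zero_of_mul h)⟩
  have hc' := intTri_mul_halfWeight_cross (z := z) (j := j) (c := c) (u := Xm * Yp)
    fun h => ⟨hYp' (right_ne_zero_of_mul h), hXm' (left_ne_zero_of_mul h)⟩
  have key := halfSign_fusion hε hδ
    (s := halfPow (j - 1 + x + y + z + (p + q + r + a + b + c)))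
    (Pp := halfWeight ε 1 x z r * racahSum c a r (x + ε) (z + 1) j)
    (Pm := halfWeight ε (-1) x z r * racahSum c a r (x + ε) (z - 1) j)
    (Qp := halfWeight δ 1 y z q * racahSum c b q (y + δ) (z + 1) j)
    (Qm := halfWeight δ (-1) y z q * racahSum c b q (y + δ) (z - 1) j) hj
    (by linear_combination hPp) (by linear_combination hPm) (by linear_combination hQp)
    (by linear_combination hQm) hpp hmp hpm hmm hc hc' (halfWeight_sum_up z j c)
    (halfWeight_sum_down z j c)
  obtain ⟨hs1, hs2⟩ := halfPow_add hε hδ (j - 1 + x + y + z + (p + q + r + a + b + c))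
  have hs3 := halfPow_add_two (j - 1 + x + y + z + (p + q + r + a + b + c))
  rw [show j + (x + ε) + (y + δ) + (z + 1) + (p + q + r + a + b + c) =
      j - 1 + x + y + z + (p + q + r + a + b + c) + ε + δ + 2 by ring, hs1,
    show j + (x + ε) + (y + δ) + (z - 1) + (p + q + r + a + b + c) =
      j - 1 + x + y + z + (p + q + r + a + b + c) + ε + δ by ring, hs2,
    show j + 1 + x + y + z + (p + q + r + a + b + c) =
      j - 1 + x + y + z + (p + q + r + a + b + c) + 2 by ring, hs3]
  set s := halfPow (j - 1 + x + y + z + (p + q + r + a + b + c))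
  set R := racahSum b a p (x + ε) (y + δ) j
  linear_combination intTri (x + ε) j a * intTri (y + δ) j b * R * key +
    R * (z + 1) * s * halfSign ε δ 1 * intTri z (j - 1) c *
      (intTri (y + δ) j b * Ym * hXm + halfWeight ε 1 x (j - 1) a * intTri x (j - 1) a * Um * hYm) -
    R * (z + 1) * s * halfSign ε δ (-1) * intTri z (j + 1) c *
      (intTri (y + δ) j b * Yp * hXp +
        halfWeight ε (-1) x (j + 1) a * intTri x (j + 1) a * Up * hYp)

lemma intTri_ne_zero {a b c : ℤ} (h : intTri a b c ≠ 0) : IntAdmissible a b c := by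
  by_contra h'
  exact h (if_neg h')

lemma pentagonTerm_ne_zero {p q r a b c x y z J : ℤ} (h : pentagonTerm p q r a b c x y z J ≠ 0) :
    (IntAdmissible x J a ∧ IntAdmissible y J b ∧ IntAdmissible z J c) ∧
      IntAdmissible c a r ∧ IntAdmissible c b q ∧ IntAdmissible b a p ∧
      IntAdmissible x z r ∧ IntAdmissible y z q ∧ IntAdmissible x y p := by
  simp only [pentagonTerm, mul_ne_zero_iff] at h
  obtain ⟨⟨-, ⟨h1, h2⟩, h3⟩, ⟨h4, h5⟩, h6⟩ := h
  obtain ⟨h7, -, -, h8⟩ := racahSum_ne_zero h4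
  obtain ⟨h9, -, -, h10⟩ := racahSum_ne_zero h5
  obtain ⟨h11, -, -, h12⟩ := racahSum_ne_zero h6
  exact ⟨⟨intTri_ne_zero h1, intTri_ne_zero h2, intTri_ne_zero h3⟩, h7, h9, h11, h8, h10, h12⟩

lemma summable_pentagonTerm (p q r a b c x y z : ℤ) :
    Summable (pentagonTerm p q r a b c x y z) :=
  summable_of_bounds 0 (x + a) fun J hJ => by
    have := (pentagonTerm_ne_zero hJ).1.1
    unfold IntAdmissible at this
    omega

lemma summable_pentagonStep (p q r a b c x y z ε δ η : ℤ) :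
    Summable (pentagonStep p q r a b c x y z ε δ η) :=
  summable_of_bounds 0 (x + a) fun J hJ => by
    simp only [pentagonStep, mul_ne_zero_iff] at hJ
    have := intTri_ne_zero hJ.1.1.2.1.1
    unfold IntAdmissible at this
    omega

lemma pentagonSum_recurrence {p q r a b c : ℤ} (hr : 0 ≤ c + a + r) (hq : 0 ≤ c + b + q)
    (hp : 0 ≤ b + a + p) {ε δ : ℤ} (hε : ε = 1 ∨ ε = -1) (hδ : δ = 1 ∨ δ = -1) (x y z : ℤ) :
    ((z : ℝ) + 1) * (halfWeight (-ε) (-δ) (x + ε) (y + δ) p * pentagonSum p q r a b c x y z) =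
      halfSign ε δ 1 * (halfWeight δ 1 y z q * halfWeight ε 1 x z r) *
          pentagonSum p q r a b c (x + ε) (y + δ) (z + 1) +
        halfSign ε δ (-1) * (halfWeight δ (-1) y z q * halfWeight ε (-1) x z r) *
          pentagonSum p q r a b c (x + ε) (y + δ) (z - 1) := by
  simp only [pentagonSum]
  rw [← tsum_mul_left, ← tsum_mul_left, ← tsum_mul_left, ← tsum_mul_left,
    ← ((summable_pentagonTerm ..).mul_left _).tsum_add ((summable_pentagonTerm ..).mul_left _),
    tsum_congr (pentagonTerm_recurrence p q r a b c hr hq hε hδ x y z)]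
  simp only [sub_eq_add_neg]
  rw [(summable_shift (summable_pentagonStep ..) (-1)).tsum_add
    (summable_shift (summable_pentagonStep ..) 1), tsum_shift, tsum_shift,
    ← (summable_pentagonStep ..).tsum_add (summable_pentagonStep ..)]
  refine tsum_congr fun J => ?_
  have h := racahSum_recurrence hp hε hδ x y J
  simp only [pentagonTerm, pentagonStep, ← sub_eq_add_neg]
  linear_combination halfPow (J + x + y + z + (p + q + r + a + b + c)) * (z + 1) *
    (intTri x J a * intTri y J b * intTri z J c) *
    (racahSum c a r x z J * racahSum c b q y z J) * h

lemma eq_zero_of_recurrence {p r : ℤ} {K : ℤ → ℤ → ℤ → ℝ}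
    (hsupp : ∀ x y z, K x y z ≠ 0 → IntAdmissible x z r) (h0 : ∀ y z, K 0 y z = 0)
    (hrec : ∀ ε δ : ℤ, (ε = 1 ∨ ε = -1) → (δ = 1 ∨ δ = -1) → ∀ x y z : ℤ, ∃ α β : ℝ,
      ((z : ℝ) + 1) * (halfWeight (-ε) (-δ) (x + ε) (y + δ) p * K x y z) =
        α * K (x + ε) (y + δ) (z + 1) + β * K (x + ε) (y + δ) (z - 1)) (x : ℕ) :
    ∀ y z, K x y z = 0 := by
  induction x with
  | zero => exact_mod_cast h0
  | succ n ih =>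
    intro y z
    by_contra hne
    have hz : (z : ℝ) + 1 ≠ 0 := by
      have := hsupp _ _ _ hne
      have : 0 ≤ z := by unfold IntAdmissible at this; omega
      positivity
    have step : ∀ δ : ℤ, (δ = 1 ∨ δ = -1) → halfWeight 1 (-δ) n (y + δ) p = 0 := fun δ hδ => by
      obtain ⟨α, β, h⟩ := hrec (-1) δ (by simp) hδ (n + 1 : ℕ) y z
      rw [show ((n + 1 : ℕ) : ℤ) + -1 = n by push_cast; ring, ih, ih] at h
      simpa only [neg_neg, mul_zero, add_zero, mul_eq_zero, hz, hne, or_false, false_or] using h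
    have h1 := step 1 (by simp)
    have h2 := step (-1) (by simp)
    norm_num [halfWeight] at h1 h2
    have : (n : ℝ) + 1 = 0 := by linear_combination h1 + h2
    exact absurd this (by positivity)

lemma intTri_reverse (a b c : ℤ) : intTri a b c = intTri c b a := by
  by_cases h : IntAdmissible a b c
  · obtain ⟨p, q, r, rfl, rfl, rfl⟩ := h.exists_nat
    rw [intTri_eq, add_comm (q : ℤ) r, add_comm (p : ℤ) r, add_comm (p : ℤ) q, intTri_eq,
      show r + q + p + 1 = p + q + r + 1 by ring]
    ring
  · rw [intTri, if_neg h, intTri, if_neg fun h' => h (by unfold IntAdmissible at *; omega)]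

lemma intTri_zero_mul {a : ℤ} (ha : 0 ≤ a) : ((a : ℝ) + 1) * intTri 0 a a = 1 := by
  lift a to ℕ using ha
  have h := intTri_eq 0 0 a
  simp only [Nat.cast_zero, zero_add, Nat.factorial_zero, Nat.cast_one, one_mul, Nat.factorial_succ]
    at h
  rw [h]
  push_cast
  have : (Nat.factorial a : ℝ) ≠ 0 := by positivity
  field_simp

lemma intTri_mul_racahSum_zero {A B C : ℤ} (h : IntAdmissible A B C) :
    intTri A B C * racahSum A B C 0 C B = halfPow (A + B + C) := by
  obtain ⟨p, q, r, rfl, rfl, rfl⟩ := h.exists_nat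
  have hs : (p + q : ℤ) + (p + r) + (q + r) = 2 * (p + q + r) := by ring
  rw [racahSum, tsum_eq_single (p + q + r : ℤ)]
  · rw [intTri_eq, racahTerm, halfPow, hs, Int.mul_ediv_cancel_left _ (by norm_num),
      show 2 * ((p : ℤ) + q + r) - 2 * (p + q + r) = 2 * (0 : ℕ) by push_cast; ring,
      show 2 * ((p : ℤ) + q + r) - (p + q + (q + r) + (p + r)) = 2 * (0 : ℕ) by push_cast; ring,
      show 2 * ((p : ℤ) + q + r) - (0 + (p + r) + (p + r)) = 2 * (q : ℕ) by ring,
      show 2 * ((p : ℤ) + q + r) - (0 + (q + r) + (q + r)) = 2 * (p : ℕ) by ring,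
      show (p : ℤ) + q + (p + r) + 0 + (q + r) - 2 * (p + q + r) = 2 * (0 : ℕ) by push_cast; ring,
      show (p : ℤ) + r + (q + r) + (q + r) + (p + r) - 2 * (p + q + r) = 2 * (r : ℕ) by
        ring,
      show (q : ℤ) + r + (p + q) + (p + r) + 0 - 2 * (p + q + r) = 2 * (0 : ℕ) by push_cast; ring,
      intFact, if_pos (by positivity), show ((p : ℤ) + q + r + 1).toNat = p + q + r + 1 by omega]
    simp only [halfInvFact_two_mul]
    simp
    field_simp
  · intro s hs'
    by_contra h0
    have := (racahTerm_ne_zero h0).1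
    omega

lemma halfPow_of_even (n : ℤ) : halfPow (2 * n) = (-1) ^ n := by
  rw [halfPow, Int.mul_ediv_cancel_left _ (by norm_num)]

lemma pentagon_of_zero (p q r a b c y z : ℤ) :
    pentagonSum p q r a b c 0 y z =
      intTri q r p * racahSum q r p 0 y z * racahSum a b p q r c := by
  by_cases hy : y = p ∧ z = r ∧ IntAdmissible c a r ∧ IntAdmissible b a p ∧ IntAdmissible c b q ∧
      IntAdmissible q r p
  · obtain ⟨rfl, rfl, h1, h2, h3, h4⟩ := hy
    rw [pentagonSum, tsum_eq_single a]
    · have e0 := intTri_zero_mul (a := a) (by unfold IntAdmissible at h1; omega)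
      have e1 := intTri_mul_racahSum_zero h1
      have e2 := intTri_mul_racahSum_zero h2
      have e3 := intTri_mul_racahSum_zero h4
      have e4 : racahSum a b y q z c = racahSum c b q y z a := by
        rw [racahSum_rotate c b, racahSum_rotate b q, racahSum_flip q c, racahSum_swap a y,
          racahSum_rotate y a]
      rw [intTri_reverse] at e1 e2
      have e5 : halfPow (a + 0 + y + z + (y + q + z + a + b + c)) * halfPow (b + a + y) *
          halfPow (c + a + z) = halfPow (q + z + y) := by
        obtain ⟨A, hA⟩ : ∃ A, c + a + z = 2 * A := ⟨(c + a + z) / 2, by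
          unfold IntAdmissible at h1; omega⟩
        obtain ⟨B, hB⟩ : ∃ B, b + a + y = 2 * B := ⟨(b + a + y) / 2, by
          unfold IntAdmissible at h2; omega⟩
        obtain ⟨C, hC⟩ : ∃ C, q + z + y = 2 * C := ⟨(q + z + y) / 2, by
          unfold IntAdmissible at h4; omega⟩
        rw [show a + 0 + y + z + (y + q + z + a + b + c) = 2 * (A + B + C) by omega, hA, hB, hC,
          halfPow_of_even, halfPow_of_even, halfPow_of_even, halfPow_of_even,
          zpow_add₀ (by norm_num), zpow_add₀ (by norm_num)]
        have sq (n : ℤ) : ((-1 : ℝ) ^ n) * (-1) ^ n = 1 := by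
          rw [← mul_zpow]; norm_num
        linear_combination (-1 : ℝ) ^ C * (sq A + (-1 : ℝ) ^ A * (-1) ^ A * sq B)
      rw [pentagonTerm, e4, e3, ← e5, ← e1, ← e2]
      linear_combination halfPow (a + 0 + y + z + (y + q + z + a + b + c)) * intTri y a b *
        intTri z a c * racahSum c a z 0 z a * racahSum c b q y z a * racahSum b a y 0 y a * e0
    · intro J hJ
      by_contra h0
      have := pentagonTerm_ne_zero h0
      unfold IntAdmissible at this
      omega
  · trans 0
    · rw [pentagonSum]
      convert tsum_zero with J
      by_contra h0
      obtain ⟨⟨h1, h2, h3⟩, h4, h5, h6, h7, h8, h9⟩ := pentagonTerm_ne_zero h0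
      have e1 : y = p := by unfold IntAdmissible at h9; omega
      have e2 : z = r := by unfold IntAdmissible at h7; omega
      exact hy ⟨e1, e2, h4, h6, h5, by unfold IntAdmissible at *; omega⟩
    · by_contra h0
      obtain ⟨⟨-, h1⟩, h2⟩ := by simpa only [mul_ne_zero_iff] using Ne.symm h0
      obtain ⟨h1, -, h3, h4⟩ := racahSum_ne_zero h1
      obtain ⟨h5, h6, h7, -⟩ := racahSum_ne_zero h2
      have e1 : y = p := by unfold IntAdmissible at h4; omega
      have e2 : z = r := by unfold IntAdmissible at h3; omega
      refine hy ⟨e1, e2, ?_, ?_, ?_, h1⟩ <;> unfold IntAdmissible at * <;> omega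

lemma pentagon (p q r a b c : ℤ) (hr : 0 ≤ c + a + r) (hq : 0 ≤ c + b + q)
    (hp : 0 ≤ b + a + p) (hpqr : 0 ≤ q + r + p) (x : ℕ) (y z : ℤ) :
    pentagonSum p q r a b c x y z =
      intTri q r p * racahSum q r p x y z * racahSum a b p q r c := by
  refine sub_eq_zero.mp (eq_zero_of_recurrence (p := p) (r := r) (K := fun x y z =>
    pentagonSum p q r a b c x y z - intTri q r p * racahSum q r p x y z * racahSum a b p q r c)
    ?_ (fun y z => sub_eq_zero.mpr (pentagon_of_zero ..)) ?_ x y z)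
  · intro x y z h
    by_contra h'
    apply h
    have h1 : pentagonSum p q r a b c x y z = 0 := by
      rw [pentagonSum]
      convert tsum_zero with J
      by_contra h0
      exact h' (pentagonTerm_ne_zero h0).2.2.2.2.1
    have h2 : racahSum q r p x y z = 0 := by
      by_contra h0
      have := (racahSum_ne_zero h0).2.2.1
      exact h' (by unfold IntAdmissible at *; omega)
    simp [h1, h2]
  · intro ε δ hε hδ x y z
    have h1 := pentagonSum_recurrence hr hq hp hε hδ x y z
    have h2 := racahSum_recurrence hpqr hε hδ x y z
    refine ⟨halfSign ε δ 1 * (halfWeight δ 1 y z q * halfWeight ε 1 x z r),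
      halfSign ε δ (-1) * (halfWeight δ (-1) y z q * halfWeight ε (-1) x z r), ?_⟩
    linear_combination h1 - intTri q r p * racahSum a b p q r c * h2

lemma triCoef_eq_intTri {a b c : ℕ} (h : Admissible a b c) : triCoef a b c = intTri a b c := by
  unfold Admissible at h
  rw [triCoef, intTri, if_pos (by unfold IntAdmissible; omega)]
  push_cast
  congr 5 <;> omega

lemma intTri_nonneg (a b c : ℤ) : 0 ≤ intTri a b c := by
  unfold intTri
  split_ifs <;> positivity

lemma IntAdmissible.admissible {a b c : ℕ} (h : IntAdmissible a b c) : Admissible a b c := by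
  unfold IntAdmissible at h
  unfold Admissible
  omega

lemma halfInvFact_eq {n : ℤ} {k : ℕ} (h : n = 2 * k) :
    halfInvFact n = ((Nat.factorial k : ℕ) : ℝ)⁻¹ := by
  rw [h, halfInvFact_two_mul]

lemma tsum_int_eq_tsum_nat {g : ℤ → ℝ} (hg : ∀ n, g n ≠ 0 → 0 ≤ n) :
    ∑' n : ℤ, g n = ∑' n : ℕ, g n :=
  (Nat.cast_injective.tsum_eq fun n hn => ⟨n.toNat, Int.toNat_of_nonneg (hg n hn)⟩).symm

lemma sixJ_eq (a b c d e f : ℕ) :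
    sixJ a b c d e f = Real.sqrt (intTri a b c) * Real.sqrt (intTri a e f) *
      Real.sqrt (intTri d b f) * Real.sqrt (intTri d e c) * racahSum a b c d e f := by
  by_cases h : Admissible a b c ∧ Admissible a e f ∧ Admissible d b f ∧ Admissible d e c
  · rw [sixJ, if_pos h, triCoef_eq_intTri h.1, triCoef_eq_intTri h.2.1,
      triCoef_eq_intTri h.2.2.1, triCoef_eq_intTri h.2.2.2, Real.sqrt_mul', Real.sqrt_mul',
      Real.sqrt_mul']
    rotate_left
    iterate 3 exact intTri_nonneg ..
    congr 1
    rw [racahSum, tsum_int_eq_tsum_nat fun s hs => by have := (racahTerm_ne_zero hs).1; omega,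
      tsum_eq_sum (s := Finset.range ((a + b + d + e) / 2 + 1))]
    · refine Finset.sum_congr rfl fun t _ => ?_
      unfold Admissible at h
      split_ifs with ht
      · rw [racahTerm, intFact, if_pos (by positivity),
          show ((t : ℤ) + 1).toNat = t + 1 by omega, zpow_natCast,
          halfInvFact_eq (k := t - (a + b + c) / 2) (by omega),
          halfInvFact_eq (k := t - (a + e + f) / 2) (by omega),
          halfInvFact_eq (k := t - (d + b + f) / 2) (by omega),
          halfInvFact_eq (k := t - (d + e + c) / 2) (by omega),
          halfInvFact_eq (k := (a + b + d + e) / 2 - t) (by omega),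
          halfInvFact_eq (k := (b + c + e + f) / 2 - t) (by omega),
          halfInvFact_eq (k := (c + a + f + d) / 2 - t) (by omega)]
        simp only [div_eq_mul_inv, mul_inv, mul_assoc]
      · by_contra h0
        have := (racahTerm_ne_zero (Ne.symm h0)).1
        omega
    · intro t ht
      by_contra h0
      have := (racahTerm_ne_zero h0).1
      rw [Finset.mem_range] at ht
      omega
  · rw [sixJ, if_neg h]
    by_contra h0
    obtain ⟨h1, h2, h3, h4⟩ := racahSum_ne_zero (right_ne_zero_of_mul (Ne.symm h0))
    exact h ⟨h1.admissible, h2.admissible, h3.admissible, h4.admissible⟩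

lemma halfPow_natCast (n : ℕ) : halfPow n = (-1) ^ (n / 2) := by
  rw [halfPow, show (n : ℤ) / 2 = (n / 2 : ℕ) by simp, zpow_natCast]

lemma sqrt_intTri_mul_self (a b c : ℤ) :
    Real.sqrt (intTri a b c) * Real.sqrt (intTri a b c) = intTri a b c :=
  Real.mul_self_sqrt (intTri_nonneg a b c)

lemma intTri_right_comm (a b c : ℤ) : intTri a b c = intTri a c b := by
  rw [intTri_comm, intTri_reverse, intTri_comm]

lemma intTri_rotate (a b c : ℤ) : intTri a b c = intTri b c a := by
  rw [intTri_comm, intTri_right_comm]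

/-- the Biedenharn–Elliott (pentagon) identity for Wigner 6j-symbols,
in doubled-spin variables (`J` ranges over all doubled half-integers; inadmissible
terms vanish). -/
theorem biedenharn_elliott (a1 a2 a3 a4 a5 a6 a7 a8 a9 : ℕ) :
    sixJ a1 a2 a3 a4 a5 a6 * sixJ a7 a8 a3 a4 a5 a9 =
    ∑' J : ℕ,
      (-1 : ℝ) ^ ((J + (a1 + a2 + a3 + a4 + a5 + a6 + a7 + a8 + a9)) / 2) *
        ((J : ℝ) + 1) *
        sixJ a1 a6 a5 a9 a7 J * sixJ a2 a6 a4 a9 a8 J * sixJ a1 a2 a3 a8 a7 J := by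
  have h := pentagon a3 a4 a5 a7 a8 a9 (by positivity) (by positivity) (by positivity)
    (by positivity) a1 a2 a6
  rw [pentagonSum, tsum_int_eq_tsum_nat fun J hJ => by
    have := (pentagonTerm_ne_zero hJ).1.1
    unfold IntAdmissible at this
    omega] at h
  set C := Real.sqrt (intTri a1 a2 a3) * Real.sqrt (intTri a1 a5 a6) *
    Real.sqrt (intTri a4 a2 a6) * Real.sqrt (intTri a7 a8 a3) * Real.sqrt (intTri a7 a5 a9) *
    Real.sqrt (intTri a4 a8 a9) with hC
  trans C * (intTri a4 a5 a3 * racahSum a4 a5 a3 a1 a2 a6 * racahSum a7 a8 a3 a4 a5 a9)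
  · rw [sixJ_eq, sixJ_eq, racahSum_flip a1]
    linear_combination C * racahSum a4 a5 a3 a1 a2 a6 * racahSum a7 a8 a3 a4 a5 a9 *
      sqrt_intTri_mul_self a4 a5 a3
  · rw [← h, ← tsum_mul_left]
    refine tsum_congr fun J => ?_
    rw [sixJ_eq, sixJ_eq, sixJ_eq, pentagonTerm, racahSum_flip a1, racahSum_flip a2,
      racahSum_flip a1 a2, ← halfPow_natCast]
    rw [intTri_right_comm a1 a6 a5, intTri_right_comm a1 a7 J, intTri_rotate a9 a6 J,
      intTri_rotate a9 a7 a5, intTri_reverse a2 a6 a4, intTri_right_comm a4 a6 a2,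
      intTri_right_comm a2 a8 J, intTri_reverse a9 a8 a4, intTri_comm a8 a2 J,
      intTri_right_comm a2 a8 J, intTri_comm a8 a7 a3]
    have e : ((J + (a1 + a2 + a3 + a4 + a5 + a6 + a7 + a8 + a9) : ℕ) : ℤ) =
        J + a1 + a2 + a6 + (a3 + a4 + a5 + a7 + a8 + a9) := by push_cast; ring
    have h1 := sqrt_intTri_mul_self a1 J a7
    have h2 := sqrt_intTri_mul_self a2 J a8
    have h3 := sqrt_intTri_mul_self a6 J a9
    generalize Real.sqrt (intTri a1 J a7) = s1 at h1 ⊢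
    generalize Real.sqrt (intTri a2 J a8) = s2 at h2 ⊢
    generalize Real.sqrt (intTri a6 J a9) = s3 at h3 ⊢
    rw [e, hC, ← h1, ← h2, ← h3]
    push_cast
    ring
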